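/- If G is a (k,ℓ)-pebble-game graph, then G has a canonical pebble game construction, i.e., a sequence of moves constructing G in which every add-edge move covers the new edge with a pebble of a color present on both endpoints when such a color exists and otherwise with a pebble of the highest-numbered color present, and no pebble-slide move creates a monochromatic cycle. -/

import Mathlib

open scoped Classical

namespace PebbleGame

/-- A configuration of the `(k,ℓ)`-pebble game with colors: a directed multigraph
whose edges are records `(tail, head, color)` (the color of an edge is the color of
the unique pebble lying on it), together with the multiset of colors of the pebbles
sitting on each vertex. -/
structure PGConfig (V : Type) (k : ℕ) where
  edges : Multiset (V × V × Fin k)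
  pebs : V → Multiset (Fin k)

variable {V : Type} [DecidableEq V] {k ℓ : ℕ}

/-- The configuration resulting from an add-edge move: a pebble of color `c` is picked
up from `v`, the directed edge `vw` is added and the pebble is placed on it. -/
def addEdgeCfg (H : PGConfig V k) (v w : V) (c : Fin k) : PGConfig V k :=
  ⟨(v, w, c) ::ₘ H.edges, Function.update H.pebs v ((H.pebs v).erase c)⟩

/-- The configuration resulting from a pebble-slide move along the edge `(v, w, c)`,
using a pebble of color `c'` on `w`: the edge `vw` is replaced by `wv`, the pebble of
color `c` that was on the edge goes to `v`, and the pebble of color `c'` from `w` is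
placed on the new edge `wv`. -/
def slideCfg (H : PGConfig V k) (v w : V) (c c' : Fin k) : PGConfig V k :=
  ⟨(w, v, c') ::ₘ H.edges.erase (v, w, c),
    Function.update (Function.update H.pebs w ((H.pebs w).erase c')) v
      (c ::ₘ Function.update H.pebs w ((H.pebs w).erase c') v)⟩

/-- A legal move of the `(k,ℓ)`-pebble game with colors. -/
inductive Step (k ℓ : ℕ) : PGConfig V k → PGConfig V k → Prop
  | add (H : PGConfig V k) (v w : V) (c : Fin k)
      (hpeb : ℓ + 1 ≤ ∑ u ∈ ({v, w} : Finset V), (H.pebs u).card)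
      (hc : c ∈ H.pebs v) :
      Step k ℓ H (addEdgeCfg H v w c)
  | slide (H : PGConfig V k) (v w : V) (c c' : Fin k)
      (he : (v, w, c) ∈ H.edges)
      (hc : c' ∈ H.pebs w) :
      Step k ℓ H (slideCfg H v w c c')

/-- The initial configuration: no edges, and one pebble of each of the `k` colors on
every vertex. -/
def initCfg (V : Type) [DecidableEq V] [Fintype V] (k : ℕ) : PGConfig V k :=
  ⟨0, fun _ => Finset.univ.val⟩

/-- A configuration is reachable if it arises from the initial configuration by a
finite sequence of legal moves. -/
def Reachable [Fintype V] (k ℓ : ℕ) (H : PGConfig V k) : Prop :=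
  Relation.ReflTransGen (Step k ℓ) (initCfg V k) H

/-- The underlying undirected multigraph (multiset of edges) of a configuration. -/
def undirected (H : PGConfig V k) : Multiset (Sym2 V) :=
  H.edges.map fun e => s(e.1, e.2.1)

/-- The (undirected) edges of a configuration carrying a pebble of color `c`. -/
def monoEdges (H : PGConfig V k) (c : Fin k) : Multiset (Sym2 V) :=
  (H.edges.filter fun e => e.2.2 = c).map fun e => s(e.1, e.2.1)

/-- The undirected edges of color `c` among a multiset `F` of directed colored
edges. -/
def monoOf (F : Multiset (V × V × Fin k)) (c : Fin k) : Multiset (Sym2 V) :=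
  (F.filter fun e => e.2.2 = c).map fun e => s(e.1, e.2.1)

/-- `G` (a multiset of undirected edges on the fixed finite vertex set `V`) is a
`(k,ℓ)`-pebble-game graph if it is the underlying undirected multigraph of some
reachable configuration. -/
def PebbleGameGraph [Fintype V] (k ℓ : ℕ) (E : Multiset (Sym2 V)) : Prop :=
  ∃ H : PGConfig V k, Reachable k ℓ H ∧ undirected H = E

/-- The edges of `E` spanned by the vertex set `S` (both endpoints in `S`). -/
def spanned (E : Multiset (Sym2 V)) (S : Finset V) : Multiset (Sym2 V) :=
  E.filter fun e => e ∈ S.sym2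

/-- A multigraph is `(k,ℓ)`-sparse if every nonempty set of `n'` vertices spans at
most `k n' - ℓ` edges. -/
def Sparse (k ℓ : ℕ) (E : Multiset (Sym2 V)) : Prop :=
  ∀ S : Finset V, S.Nonempty → (spanned E S).card ≤ k * S.card - ℓ

/-- A multigraph is `(k,ℓ)`-tight if it is `(k,ℓ)`-sparse with exactly `k|V| - ℓ`
edges. -/
def Tight [Fintype V] (k ℓ : ℕ) (E : Multiset (Sym2 V)) : Prop :=
  Sparse k ℓ E ∧ E.card = k * Fintype.card V - ℓ

/-- Connectivity (as undirected multigraphs) via the edges of `F`. -/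
def Conn (F : Multiset (Sym2 V)) : V → V → Prop :=
  Relation.ReflTransGen fun a b => s(a, b) ∈ F

/-- The connected components of the graph with vertex set `S` and edge multiset `F`
(whose edges are assumed to be spanned by `S`), as a finset of vertex sets. -/
noncomputable def components (S : Finset V) (F : Multiset (Sym2 V)) : Finset (Finset V) :=
  S.image fun v => S.filter fun u => Conn F v u

/-- The tree-pieces of the graph `(S, F)`: connected components that contain no cycle,
i.e. whose spanned edge count is exactly one less than their vertex count (an isolated
vertex is a tree-piece). -/
noncomputable def treePieces (S : Finset V) (F : Multiset (Sym2 V)) : Finset (Finset V) :=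
  (components S F).filter fun C => (spanned F C).card + 1 = C.card

/-- The number of tree-pieces of the graph `(S, F)`. -/
noncomputable def treePieceCount (S : Finset V) (F : Multiset (Sym2 V)) : ℕ :=
  (treePieces S F).card

/-- A multigraph contains a cycle iff some nonempty vertex set spans at least as many
edges as it has vertices. -/
def HasCycle (F : Multiset (Sym2 V)) : Prop :=
  ∃ S : Finset V, S.Nonempty ∧ S.card ≤ (spanned F S).card

/-- A spanning tree on the whole (finite) vertex set: connected with `|V| - 1` edges. -/
def IsSpanningTree [Fintype V] (T : Multiset (Sym2 V)) : Prop :=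
  (∀ u v : V, Conn T u v) ∧ T.card + 1 = Fintype.card V

/-- A spanning map-graph: the edges admit an orientation in which every vertex has
out-degree exactly one. -/
def IsSpanningMapGraph [Fintype V] (T : Multiset (Sym2 V)) : Prop :=
  ∃ M : Multiset (V × V), M.map (fun p => s(p.1, p.2)) = T ∧
    ∀ v : V, (M.filter fun p => p.1 = v).card = 1

/-- A `(k,ℓ)`-maps-and-trees decomposition: `ℓ` edge-disjoint spanning trees and
`k - ℓ` edge-disjoint spanning map-graphs whose union is `E`. -/
def MapsAndTrees [Fintype V] (k ℓ : ℕ) (E : Multiset (Sym2 V)) : Prop :=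
  ∃ (T : Fin ℓ → Multiset (Sym2 V)) (M : Fin (k - ℓ) → Multiset (Sym2 V)),
    ((∑ i, T i) + ∑ j, M j) = E ∧ (∀ i, IsSpanningTree (T i)) ∧
      ∀ j, IsSpanningMapGraph (M j)

/-- `(S, T)` is a (possibly single-vertex) tree: nonempty vertex set `S`, edges spanned
by `S`, connected on `S`, and `|T| + 1 = |S|`. -/
def IsTreeOn (S : Finset V) (T : Multiset (Sym2 V)) : Prop :=
  S.Nonempty ∧ (∀ e ∈ T, e ∈ S.sym2) ∧ (∀ u ∈ S, ∀ v ∈ S, Conn T u v) ∧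
    T.card + 1 = S.card

/-- An `ℓTk` decomposition of `E`: `ℓ` edge-disjoint (not necessarily spanning,
possibly single-vertex) trees `(S i, T i)` whose edges partition `E`, such that every
vertex belongs to exactly `k` of the trees. -/
def LTkDecomp (k ℓ : ℕ) (E : Multiset (Sym2 V)) (S : Fin ℓ → Finset V)
    (T : Fin ℓ → Multiset (Sym2 V)) : Prop :=
  (∑ i, T i) = E ∧ (∀ i, IsTreeOn (S i) (T i)) ∧
    ∀ v : V, (Finset.univ.filter fun i => v ∈ S i).card = k

/-- A proper `ℓTk`: an `ℓTk` decomposition such that every nonempty subgraph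
(vertex set `U`, together with a sub-multiset `F i` of each tree spanned by `U`)
contains at least `ℓ` tree-pieces, the tree-pieces being the connected components of
the intersections of the trees with the subgraph. -/
def ProperLTk (k ℓ : ℕ) (E : Multiset (Sym2 V)) : Prop :=
  ∃ (S : Fin ℓ → Finset V) (T : Fin ℓ → Multiset (Sym2 V)),
    LTkDecomp k ℓ E S T ∧
      ∀ U : Finset V, U.Nonempty →
        ∀ F : Fin ℓ → Multiset (Sym2 V),
          (∀ i, F i ≤ T i) → (∀ i, ∀ e ∈ F i, e ∈ U.sym2) →
            ℓ ≤ ∑ i, treePieceCount (U ∩ S i) (F i)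

/-- One pebble-slide move (as a relation between configurations). -/
def SlideRel (k : ℕ) (A B : PGConfig V k) : Prop :=
  ∃ (v w : V) (c c' : Fin k), (v, w, c) ∈ A.edges ∧ c' ∈ A.pebs w ∧
    B = slideCfg A v w c c'

/-- A canonical move of the `(k,ℓ)`-pebble game with colors: add-edge moves cover the
new edge with a color present on both endpoints if one exists, and otherwise with the
highest-numbered color present; pebble-slide moves never create a monochromatic
cycle. -/
inductive CanStep (k ℓ : ℕ) : PGConfig V k → PGConfig V k → Prop
  | add (H : PGConfig V k) (v w : V) (c : Fin k)
      (hpeb : ℓ + 1 ≤ ∑ u ∈ ({v, w} : Finset V), (H.pebs u).card)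
      (hc : c ∈ H.pebs v)
      (hcanon : c ∈ H.pebs w ∨
        ((∀ c' : Fin k, c' ∈ H.pebs v → c' ∉ H.pebs w) ∧
          ∀ c' : Fin k, (c' ∈ H.pebs v ∨ c' ∈ H.pebs w) → c' ≤ c)) :
      CanStep k ℓ H (addEdgeCfg H v w c)
  | slide (H : PGConfig V k) (v w : V) (c c' : Fin k)
      (he : (v, w, c) ∈ H.edges)
      (hc : c' ∈ H.pebs w)
      (hnocycle : ∀ i : Fin k,
        HasCycle (monoEdges (slideCfg H v w c c') i) → HasCycle (monoEdges H i)) :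
      CanStep k ℓ H (slideCfg H v w c c')

/-- The graph obtained from a configuration by replacing every pebble lying on a
vertex by a loop at that vertex. -/
def withLoops [Fintype V] (H : PGConfig V k) : Multiset (Sym2 V) :=
  undirected H + Finset.univ.val.bind fun v => Multiset.replicate (H.pebs v).card s(v, v)

end PebbleGame
open PebbleGame

namespace PebbleGame

variable {V : Type} [DecidableEq V] {k ℓ : ℕ}

lemma countP_mem_and {α β : Type*} [DecidableEq β] (f : α → β) (S : Finset β)
    (P : α → Prop) [DecidablePred P] (E : Multiset α) :
    E.countP (fun e => f e ∈ S ∧ P e) = ∑ x ∈ S, E.countP (fun e => f e = x ∧ P e) := by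
  induction E using Multiset.induction with
  | empty => simp
  | cons a E ih =>
    simp only [Multiset.countP_cons, Finset.sum_add_distrib, ih]
    congr 1
    by_cases hP : P a <;> simp [hP]

lemma exists_seq_of_reflTransGen {α : Type*} {r : α → α → Prop} {a b : α}
    (h : Relation.ReflTransGen r a b) :
    ∃ (n : ℕ) (q : ℕ → α), q 0 = a ∧ q n = b ∧ ∀ i < n, r (q i) (q (i + 1)) := by
  induction h using Relation.ReflTransGen.head_induction_on with
  | refl => exact ⟨0, fun _ => b, rfl, rfl, by simp⟩
  | head hac _ ih =>
    rename_i a c _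
    obtain ⟨n, q, h0, hn, hq⟩ := ih
    refine ⟨n + 1, fun i => Nat.casesOn i a q, rfl, hn, fun i hi => ?_⟩
    cases i with
    | zero => simpa [h0] using hac
    | succ i => exact hq i (by omega)

lemma reflTransGen_of_seq {α : Type*} {r : α → α → Prop} {n : ℕ} {q : ℕ → α}
    (hq : ∀ i < n, r (q i) (q (i + 1))) {i : ℕ} (hi : i ≤ n) :
    Relation.ReflTransGen r (q i) (q n) := by
  induction hi using Nat.decreasingInduction with
  | self => exact .refl
  | of_succ i hi ih => exact ih.head (hq i hi)

/-- Every vertex has, in each color, either a pebble or exactly one outgoing edge. -/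
def Balanced (H : PGConfig V k) : Prop :=
  ∀ (v : V) (c : Fin k),
    (H.pebs v).count c + H.edges.countP (fun e => e.1 = v ∧ e.2.2 = c) = 1

lemma balanced_initCfg [Fintype V] : Balanced (initCfg V k) := by
  intro v c
  simp [initCfg, Multiset.count_eq_one_of_mem Finset.univ.nodup (Finset.mem_univ_val c)]

lemma Balanced.addEdge {H : PGConfig V k} (hH : Balanced H) (v w : V) {c : Fin k}
    (hc : c ∈ H.pebs v) : Balanced (addEdgeCfg H v w c) := by
  intro x d
  have := hH x d
  obtain ⟨P, hP⟩ := Multiset.exists_cons_of_mem hc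
  by_cases hx : x = v
  · subst hx
    simp only [addEdgeCfg, hP, Function.update_self, Multiset.erase_cons_head,
      Multiset.countP_cons, Multiset.count_cons] at this ⊢
    grind
  · simpa [addEdgeCfg, hx, Ne.symm hx, Multiset.countP_cons] using this

lemma Balanced.slide {H : PGConfig V k} (hH : Balanced H) {v w : V} {c c' : Fin k}
    (he : (v, w, c) ∈ H.edges) (hc : c' ∈ H.pebs w) : Balanced (slideCfg H v w c c') := by
  intro x d
  have := hH x d
  obtain ⟨P, hP⟩ := Multiset.exists_cons_of_mem hc
  obtain ⟨F, hF⟩ := Multiset.exists_cons_of_mem he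
  simp only [slideCfg, hP, hF, Multiset.erase_cons_head, Multiset.countP_cons] at this ⊢
  by_cases hx : x = v <;> by_cases hw : x = w <;> by_cases hvw : v = w <;>
    simp_all [Multiset.count_cons] <;> grind

lemma Balanced.step {H H' : PGConfig V k} (hH : Balanced H) (h : Step k ℓ H H') :
    Balanced H' := by
  cases h with
  | add v w c _ hc => exact hH.addEdge v w hc
  | slide v w c c' he hc => exact hH.slide he hc

lemma undirected_slideCfg {H : PGConfig V k} {v w : V} {c : Fin k} (c' : Fin k)
    (he : (v, w, c) ∈ H.edges) : undirected (slideCfg H v w c c') = undirected H := by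
  obtain ⟨F, hF⟩ := Multiset.exists_cons_of_mem he
  simp [undirected, slideCfg, hF, Sym2.eq_swap]

lemma card_pebs_slideCfg {H : PGConfig V k} (v : V) {w : V} (c : Fin k) {c' : Fin k}
    (hc : c' ∈ H.pebs w) (x : V) :
    ((slideCfg H v w c c').pebs x).card + (if x = w then 1 else 0) =
      (H.pebs x).card + if x = v then 1 else 0 := by
  obtain ⟨P, hP⟩ := Multiset.exists_cons_of_mem hc
  by_cases hx : x = v <;> by_cases hw : x = w <;> by_cases hvw : v = w <;>
    simp_all [slideCfg]

lemma Balanced.not_mem_edges {H : PGConfig V k} (hH : Balanced H) {w x : V} {c : Fin k}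
    (hc : c ∈ H.pebs w) : (w, x, c) ∉ H.edges := by
  intro he
  have h1 := Multiset.one_le_count_iff_mem.2 hc
  have h2 : 0 < H.edges.countP (fun e => e.1 = w ∧ e.2.2 = c) :=
    Multiset.countP_pos.2 ⟨_, he, rfl, rfl⟩
  have := hH w c
  omega

lemma Balanced.countP_le_one {H : PGConfig V k} (hH : Balanced H) (v : V) (c : Fin k)
    (P : V × V × Fin k → Prop) [DecidablePred P] :
    H.edges.countP (fun e => e.1 = v ∧ e.2.2 = c ∧ P e) ≤ 1 := by
  refine le_trans ?_ ((Nat.le_add_left _ _).trans (hH v c).le)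
  simp only [Multiset.countP_eq_card_filter]
  exact Multiset.card_le_card (Multiset.monotone_filter_right _ fun _ h => ⟨h.1, h.2.1⟩)

lemma card_spanned_monoEdges (H : PGConfig V k) (c : Fin k) (S : Finset V) :
    (spanned (monoEdges H c) S).card =
      ∑ x ∈ S, H.edges.countP (fun e => e.1 = x ∧ e.2.2 = c ∧ e.2.1 ∈ S) := by
  rw [← countP_mem_and (fun e : V × V × Fin k => e.1) S
    (fun e => e.2.2 = c ∧ e.2.1 ∈ S)]
  simp only [spanned, monoEdges, Multiset.filter_map, Multiset.card_map, Multiset.filter_filter,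
    Multiset.countP_eq_card_filter]
  congr 1
  refine Multiset.filter_congr fun e _ => ?_
  simp only [Function.comp_apply, Finset.mk_mem_sym2_iff]
  tauto

lemma HasCycle.mono {F F' : Multiset (Sym2 V)} (h : F ≤ F') (hF : HasCycle F) : HasCycle F' := by
  obtain ⟨S, hS, hcard⟩ := hF
  exact ⟨S, hS, hcard.trans (Multiset.card_le_card (Multiset.filter_le_filter _ h))⟩

lemma monoEdges_slideCfg_same {H : PGConfig V k} {v w : V} {c : Fin k}
    (he : (v, w, c) ∈ H.edges) (i : Fin k) :
    monoEdges (slideCfg H v w c c) i = monoEdges H i := by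
  obtain ⟨F, hF⟩ := Multiset.exists_cons_of_mem he
  by_cases hi : c = i <;> simp [monoEdges, slideCfg, hF, hi, Sym2.eq_swap]

lemma monoEdges_slideCfg_le {H : PGConfig V k} {v w : V} {c c' i : Fin k}
    (he : (v, w, c) ∈ H.edges) (hi : i ≠ c') :
    monoEdges (slideCfg H v w c c') i ≤ monoEdges H i := by
  obtain ⟨F, hF⟩ := Multiset.exists_cons_of_mem he
  by_cases hci : c = i <;> simp [monoEdges, slideCfg, hF, hi.symm, hci, Multiset.le_cons_self]

lemma monoEdges_slideCfg_of_ne {H : PGConfig V k} {v w : V} {c c' : Fin k}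
    (he : (v, w, c) ∈ H.edges) (hc : c ≠ c') :
    monoEdges (slideCfg H v w c c') c' = s(w, v) ::ₘ monoEdges H c' := by
  obtain ⟨F, hF⟩ := Multiset.exists_cons_of_mem he
  simp [monoEdges, slideCfg, hF, hc]

/-- If joining `v` to a root `w` of the color `c` closes a cycle of color `c`, then `v` is
already joined to `w` by a directed path of color `c`. -/
lemma Balanced.reflTransGen_of_hasCycle_cons {H : PGConfig V k} (hH : Balanced H) {v w : V}
    {c : Fin k} (hc : c ∈ H.pebs w) (hcyc : HasCycle (s(w, v) ::ₘ monoEdges H c))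
    (hno : ¬ HasCycle (monoEdges H c)) :
    Relation.ReflTransGen (fun a b => (a, b, c) ∈ H.edges) v w := by
  obtain ⟨S, hS, hcard⟩ := hcyc
  have hlt : (spanned (monoEdges H c) S).card < S.card := by
    by_contra! h
    exact hno ⟨S, hS, h⟩
  have hmem : w ∈ S ∧ v ∈ S := by
    by_contra h
    rw [spanned, Multiset.filter_cons_of_neg _ (by simpa using h)] at hcard
    exact absurd hcard (not_le.2 hlt)
  have hcard' : S.card ≤ (spanned (monoEdges H c) S).card + 1 := by
    rwa [spanned, Multiset.filter_cons_of_pos _ (by simpa using hmem), Multiset.card_cons]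
      at hcard
  rw [card_spanned_monoEdges] at hcard'
  have hout : ∀ u ∈ S, u ≠ w → ∃ y ∈ S, (u, y, c) ∈ H.edges := by
    intro u hu huw
    by_contra! hcon
    have hzero : ∀ x ∈ S, x ∉ (S.erase u).erase w →
        H.edges.countP (fun e => e.1 = x ∧ e.2.2 = c ∧ e.2.1 ∈ S) = 0 := by
      intro x hx hx'
      refine Multiset.countP_eq_zero.2 ?_
      rintro ⟨a, b, d⟩ he ⟨rfl, rfl, hb⟩
      by_cases haw : a = w
      · exact hH.not_mem_edges hc (haw ▸ he)
      · have : a = u := by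
          by_contra hau
          exact hx' (by simp [haw, hau, hx])
        exact hcon b hb (this ▸ he)
    rw [← Finset.sum_subset ((Finset.erase_subset _ _).trans (Finset.erase_subset _ _)) hzero]
      at hcard'
    have h1 := Finset.sum_le_card_nsmul ((S.erase u).erase w) _ 1
      fun x _ => hH.countP_le_one x c (fun e => e.2.1 ∈ S)
    have h2 := Finset.card_erase_add_one (Finset.mem_erase.2 ⟨huw.symm, hmem.1⟩)
    have h3 := Finset.card_erase_add_one hu
    simp only [smul_eq_mul, mul_one] at h1
    omega
  by_contra hv
  refine hno ⟨S.filter fun x => ¬ Relation.ReflTransGen (fun a b => (a, b, c) ∈ H.edges) x w,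
    ⟨v, by simp [hmem.2, hv]⟩, ?_⟩
  rw [card_spanned_monoEdges, Finset.card_eq_sum_ones]
  refine Finset.sum_le_sum fun x hx => ?_
  rw [Finset.mem_filter] at hx
  obtain ⟨y, hy, he⟩ := hout x hx.1 (by rintro rfl; exact hx.2 .refl)
  exact Multiset.countP_pos.2 ⟨_, he, rfl, rfl,
    Finset.mem_filter.2 ⟨hy, fun h => hx.2 (h.head he)⟩⟩

/-- Canonical pebble slides lead from `H` to `H'` and move one pebble from `w` to `u`. -/
structure MovesPebble (k ℓ : ℕ) (H H' : PGConfig V k) (w u : V) : Prop where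
  steps : Relation.ReflTransGen (CanStep k ℓ) H H'
  undirected_eq : undirected H' = undirected H
  balanced : Balanced H'
  card_pebs : ∀ x, (H'.pebs x).card + (if x = w then 1 else 0) =
    (H.pebs x).card + if x = u then 1 else 0

lemma MovesPebble.refl {H : PGConfig V k} (hH : Balanced H) (w : V) :
    MovesPebble k ℓ H H w w :=
  ⟨.refl, rfl, hH, fun _ => rfl⟩

lemma MovesPebble.trans {H₁ H₂ H₃ : PGConfig V k} {a b c : V}
    (h₁ : MovesPebble k ℓ H₁ H₂ a b) (h₂ : MovesPebble k ℓ H₂ H₃ b c) :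
    MovesPebble k ℓ H₁ H₃ a c :=
  ⟨h₁.steps.trans h₂.steps, h₂.undirected_eq.trans h₁.undirected_eq, h₂.balanced, fun x => by
    have := h₁.card_pebs x
    have := h₂.card_pebs x
    omega⟩

lemma Balanced.movesPebble_slideCfg {H : PGConfig V k} (hH : Balanced H) {v w : V}
    {c c' : Fin k} (he : (v, w, c) ∈ H.edges) (hc : c' ∈ H.pebs w)
    (hno : ∀ i, HasCycle (monoEdges (slideCfg H v w c c') i) → HasCycle (monoEdges H i)) :
    MovesPebble k ℓ H (slideCfg H v w c c') w v :=
  ⟨.single (.slide H v w c c' he hc hno), undirected_slideCfg c' he, hH.slide he hc,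
    card_pebs_slideCfg v c hc⟩

lemma mem_edges_slideCfg {H : PGConfig V k} {v w : V} {c c' : Fin k} {e : V × V × Fin k}
    (he : e ∈ H.edges) (hne : e ≠ (v, w, c)) : e ∈ (slideCfg H v w c c').edges :=
  Multiset.mem_cons_of_mem ((Multiset.mem_erase_of_ne hne).2 he)

lemma mem_pebs_slideCfg (H : PGConfig V k) (v w : V) (c c' : Fin k) :
    c ∈ (slideCfg H v w c c').pebs v := by
  simp [slideCfg]

/-- A pebble can be moved backwards along a directed path of its own color. -/
lemma Balanced.exists_movesPebble_of_mono {c : Fin k} (n : ℕ) (q : ℕ → V) :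
    ∀ {H : PGConfig V k}, Balanced H → c ∈ H.pebs (q n) →
      (∀ i < n, (q i, q (i + 1), c) ∈ H.edges) →
      ∃ H', MovesPebble k ℓ H H' (q n) (q 0) ∧ c ∈ H'.pebs (q 0) ∧
        ∀ e ∈ H.edges, (∀ i ≤ n, e.1 ≠ q i) → e ∈ H'.edges := by
  induction n with
  | zero => exact fun hH hc _ => ⟨_, .refl hH _, hc, fun e he _ => he⟩
  | succ n ih =>
    intro H hH hc hq
    have he := hq n n.lt_succ_self
    have hmove := hH.movesPebble_slideCfg (ℓ := ℓ) he hc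
      fun i hi => by rwa [monoEdges_slideCfg_same he] at hi
    have hhead : ∀ i < n, q (i + 1) ≠ q (n + 1) := fun i hi heq =>
      hH.not_mem_edges hc (heq ▸ hq (i + 1) (by omega))
    obtain ⟨H', hH', hc', hedges⟩ := ih hmove.balanced (mem_pebs_slideCfg _ _ _ _ _)
      fun i hi => mem_edges_slideCfg (hq i (by omega)) (by simp [hhead i hi])
    refine ⟨H', hmove.trans hH', hc', fun e he' hne => hedges e (mem_edges_slideCfg he' ?_) ?_⟩
    · rintro rfl
      exact hne n (by omega) rfl
    · exact fun i hi => hne i (by omega)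

/-- A pebble can be moved canonically from the end of a directed path to its start. -/
lemma Balanced.exists_movesPebble (m : ℕ) :
    ∀ (p : ℕ → V) {H : PGConfig V k}, Balanced H → H.pebs (p m) ≠ 0 →
      (∀ i < m, ∃ c, (p i, p (i + 1), c) ∈ H.edges) →
      ∃ H', MovesPebble k ℓ H H' (p m) (p 0) := by
  induction m using Nat.strong_induction_on with
  | _ m ih =>
  intro p H hH hpeb hp
  cases m with
  | zero => exact ⟨H, .refl hH _⟩
  | succ m =>
  obtain ⟨c', hc'⟩ := Multiset.exists_mem_of_ne_zero hpeb
  obtain ⟨c, he⟩ := hp m m.lt_succ_self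
  by_cases hno : ∀ i, HasCycle (monoEdges (slideCfg H (p m) (p (m + 1)) c c') i) →
      HasCycle (monoEdges H i)
  · have hmove := hH.movesPebble_slideCfg (ℓ := ℓ) he hc' hno
    have hex : ∃ j, p j = p m := ⟨m, rfl⟩
    have hj := Nat.find_spec hex
    have hjm : Nat.find hex ≤ m := Nat.find_min' hex rfl
    have hlt : ∀ i < Nat.find hex, p i ≠ p m := fun i hi => Nat.find_min hex hi
    generalize Nat.find hex = j at hj hjm hlt
    obtain ⟨H', hH'⟩ := ih j (by omega) p hmove.balanced
      (by rw [hj]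
          exact ne_of_mem_of_not_mem' (mem_pebs_slideCfg _ _ _ _ _) (Multiset.notMem_zero _))
      fun i hi => (hp i (by omega)).imp fun d hd =>
        mem_edges_slideCfg hd (by simp [hlt i hi])
    rw [hj] at hH'
    exact ⟨H', hmove.trans hH'⟩
  · push Not at hno
    obtain ⟨i, hcyc, hnocyc⟩ := hno
    obtain rfl : i = c' := by
      by_contra hi
      exact hnocyc (hcyc.mono (monoEdges_slideCfg_le he hi))
    have hci : c ≠ i := by
      rintro rfl
      exact hnocyc (monoEdges_slideCfg_same he c ▸ hcyc)
    rw [monoEdges_slideCfg_of_ne he hci] at hcyc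
    have hex : ∃ j, Relation.ReflTransGen (fun a b => (a, b, i) ∈ H.edges) (p j) (p (m + 1)) :=
      ⟨m, hH.reflTransGen_of_hasCycle_cons hc' hcyc hnocyc⟩
    have hj := Nat.find_spec hex
    have hjm : Nat.find hex ≤ m :=
      Nat.find_min' hex (hH.reflTransGen_of_hasCycle_cons hc' hcyc hnocyc)
    have hlt := fun t (ht : t < Nat.find hex) => Nat.find_min hex ht
    generalize Nat.find hex = j at hj hjm hlt
    obtain ⟨n, q, hq0, hqn, hq⟩ := exists_seq_of_reflTransGen hj
    obtain ⟨H₁, hmove, hpeb₁, hedges⟩ :=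
      hH.exists_movesPebble_of_mono (ℓ := ℓ) n q (hqn ▸ hc') hq
    rw [hq0] at hmove hpeb₁
    obtain ⟨H', hH'⟩ := ih j (by omega) p hmove.balanced
      (ne_of_mem_of_not_mem' hpeb₁ (Multiset.notMem_zero _))
      fun t ht => (hp t (by omega)).imp fun d hd => hedges _ hd fun s hs heq => by
        have heq : p t = q s := heq
        refine hlt t ht ?_
        rw [heq, ← hqn]
        exact reflTransGen_of_seq hq hs
    rw [hqn] at hmove
    exact ⟨H', hmove.trans hH'⟩

lemma Balanced.sum_card_pebs_add_countP {H : PGConfig V k} (hH : Balanced H) (S : Finset V) :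
    ∑ x ∈ S, (H.pebs x).card + H.edges.countP (fun e => e.1 ∈ S) = k * S.card := by
  have hcount : H.edges.countP (fun e => e.1 ∈ S) =
      ∑ x ∈ S, ∑ c : Fin k, H.edges.countP (fun e => e.1 = x ∧ e.2.2 = c) := by
    have h1 := countP_mem_and (fun e : V × V × Fin k => e.1) S (fun _ => True) H.edges
    simp only [and_true] at h1
    rw [h1]
    refine Finset.sum_congr rfl fun x _ => ?_
    have h2 := countP_mem_and (fun e : V × V × Fin k => e.2.2) Finset.univ
      (fun e => e.1 = x) H.edges
    simp only [Finset.mem_univ, true_and] at h2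
    simp only [h2, and_comm]
  rw [hcount, ← Finset.sum_add_distrib, Finset.sum_congr rfl (g := fun _ => k) fun x _ => ?_]
  · simp [mul_comm]
  · rw [← Multiset.sum_count_eq_card (s := Finset.univ) (by simp), ← Finset.sum_add_distrib,
      Finset.sum_congr rfl fun c _ => hH x c]
    simp

lemma card_spanned_undirected (H : PGConfig V k) (S : Finset V) :
    (spanned (undirected H) S).card = H.edges.countP (fun e => e.1 ∈ S ∧ e.2.1 ∈ S) := by
  simp [spanned, undirected, Multiset.filter_map, Multiset.countP_eq_card_filter]

/-- If some configuration on the same graph has more pebbles on `T`, then a pebble outside `T`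
can be reached from `T`. -/
lemma Balanced.exists_reachable_pebble [Fintype V] {H H₀ : PGConfig V k} (hH : Balanced H)
    (hH₀ : Balanced H₀) (hE : undirected H = undirected H₀) (T : Finset V)
    (hlt : ∑ x ∈ T, (H.pebs x).card < ∑ x ∈ T, (H₀.pebs x).card) :
    ∃ x ∈ T, ∃ y ∉ T, H.pebs y ≠ 0 ∧
      Relation.ReflTransGen (fun a b => ∃ c, (a, b, c) ∈ H.edges) x y := by
  by_contra! hcon
  set S : Finset V := Finset.univ.filter fun y =>
    ∃ x ∈ T, Relation.ReflTransGen (fun a b => ∃ c, (a, b, c) ∈ H.edges) x y with hS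
  have hTS : T ⊆ S := fun x hx => Finset.mem_filter.2 ⟨Finset.mem_univ _, x, hx, .refl⟩
  have hclosed : H.edges.countP (fun e => e.1 ∈ S) =
      H.edges.countP (fun e => e.1 ∈ S ∧ e.2.1 ∈ S) := by
    refine Multiset.countP_congr rfl fun e he => ?_
    refine propext ⟨fun h => ⟨h, ?_⟩, And.left⟩
    obtain ⟨-, x, hx, hr⟩ := Finset.mem_filter.1 h
    exact Finset.mem_filter.2 ⟨Finset.mem_univ _, x, hx, hr.tail ⟨e.2.2, he⟩⟩
  have hout : H₀.edges.countP (fun e => e.1 ∈ S ∧ e.2.1 ∈ S) ≤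
      H₀.edges.countP (fun e => e.1 ∈ S) := by
    simp only [Multiset.countP_eq_card_filter]
    exact Multiset.card_le_card (Multiset.monotone_filter_right _ fun _ h => h.1)
  have hpebs : ∑ x ∈ T, (H.pebs x).card = ∑ x ∈ S, (H.pebs x).card := by
    refine Finset.sum_subset hTS fun y hy hyT => ?_
    obtain ⟨-, x, hx, hr⟩ := Finset.mem_filter.1 hy
    by_contra h
    exact hcon x hx y hyT (fun h0 => h (by simp [h0])) hr
  have hpebs₀ : ∑ x ∈ T, (H₀.pebs x).card ≤ ∑ x ∈ S, (H₀.pebs x).card :=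
    Finset.sum_le_sum_of_subset hTS
  have h1 := hH.sum_card_pebs_add_countP S
  have h2 := hH₀.sum_card_pebs_add_countP S
  rw [← card_spanned_undirected] at hclosed hout
  rw [hE] at hclosed
  omega

/-- Canonical pebble slides gather on `T` at least as many pebbles as any other configuration on
the same graph has there. -/
lemma Balanced.exists_canonical_gather [Fintype V] {H₀ : PGConfig V k} (hH₀ : Balanced H₀)
    (T : Finset V) (d : ℕ) :
    ∀ {H : PGConfig V k}, Balanced H → undirected H = undirected H₀ →
      ∑ x ∈ T, (H₀.pebs x).card ≤ ∑ x ∈ T, (H.pebs x).card + d →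
      ∃ H', Relation.ReflTransGen (CanStep k ℓ) H H' ∧ Balanced H' ∧
        undirected H' = undirected H₀ ∧
        ∑ x ∈ T, (H₀.pebs x).card ≤ ∑ x ∈ T, (H'.pebs x).card := by
  induction d with
  | zero => exact fun hH hE hle => ⟨_, .refl, hH, hE, hle⟩
  | succ d ih =>
    intro H hH hE hle
    by_cases hlt : ∑ x ∈ T, (H.pebs x).card < ∑ x ∈ T, (H₀.pebs x).card
    · obtain ⟨x, hx, y, hy, hpeb, hr⟩ := hH.exists_reachable_pebble hH₀ hE T hlt
      obtain ⟨m, p, rfl, rfl, hp⟩ := exists_seq_of_reflTransGen hr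
      obtain ⟨H₁, hmove⟩ := Balanced.exists_movesPebble (ℓ := ℓ) m p hH hpeb hp
      have hsum := Finset.sum_congr (rfl : T = T) fun z _ => hmove.card_pebs z
      simp only [Finset.sum_add_distrib, Finset.sum_ite_eq', hx, hy, if_true, if_false] at hsum
      obtain ⟨H', hsteps, h⟩ := ih hmove.balanced (hmove.undirected_eq.trans hE) (by omega)
      exact ⟨H', hmove.steps.trans hsteps, h⟩
    · exact ⟨H, .refl, hH, hE, not_lt.1 hlt⟩

lemma Balanced.exists_canonical_addEdge {H : PGConfig V k} (hH : Balanced H) (v w : V)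
    (hpeb : ℓ + 1 ≤ ∑ u ∈ ({v, w} : Finset V), (H.pebs u).card) :
    ∃ H', CanStep k ℓ H H' ∧ Balanced H' ∧ undirected H' = s(v, w) ::ₘ undirected H := by
  by_cases hcommon : ∃ c, c ∈ H.pebs v ∧ c ∈ H.pebs w
  · obtain ⟨c, hv, hw⟩ := hcommon
    exact ⟨_, .add H v w c hpeb hv (.inl hw), hH.addEdge v w hv,
      by simp [undirected, addEdgeCfg]⟩
  push Not at hcommon
  have hne : ((H.pebs v).toFinset ∪ (H.pebs w).toFinset).Nonempty := by
    by_contra h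
    simp only [Finset.not_nonempty_iff_eq_empty, Finset.union_eq_empty,
      Multiset.toFinset_eq_empty] at h
    have : ∑ u ∈ ({v, w} : Finset V), (H.pebs u).card = 0 :=
      Finset.sum_eq_zero fun u hu => by
        rcases Finset.mem_insert.1 hu with rfl | hu
        · simp [h.1]
        · simp [Finset.mem_singleton.1 hu, h.2]
    omega
  obtain ⟨c, hc, hmax⟩ := Finset.exists_max_image _ id hne
  simp only [Finset.mem_union, Multiset.mem_toFinset, id] at hc hmax
  rcases hc with hc | hc
  · exact ⟨_, .add H v w c hpeb hc (.inr ⟨hcommon, hmax⟩), hH.addEdge v w hc,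
      by simp [undirected, addEdgeCfg]⟩
  · exact ⟨_, .add H w v c (Finset.pair_comm v w ▸ hpeb) hc
      (.inr ⟨fun c' h h' => hcommon c' h' h, fun c' h => hmax c' h.symm⟩), hH.addEdge w v hc,
      by simp [undirected, addEdgeCfg, Sym2.eq_swap]⟩

end PebbleGame

/-- every `(k,ℓ)`-pebble-game graph has a canonical pebble game
construction: one in which every add-edge move covers the new edge with a pebble of a
color present on both endpoints when such a color exists and otherwise with a pebble
of the highest-numbered color present, and no pebble-slide move creates a
monochromatic cycle. -/
theorem canonical_construction_exists {V : Type} [Fintype V] [DecidableEq V]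
    (k ℓ : ℕ) (hk : 1 ≤ k) (hℓ : ℓ ≤ 2 * k - 1) (E : Multiset (Sym2 V))
    (hE : PebbleGameGraph k ℓ E) :
    ∃ H : PGConfig V k,
      Relation.ReflTransGen (CanStep k ℓ) (initCfg V k) H ∧ undirected H = E := by
  obtain ⟨H₀, hreach, rfl⟩ := hE
  suffices h : ∃ H : PGConfig V k, Relation.ReflTransGen (CanStep k ℓ) (initCfg V k) H ∧
      undirected H = undirected H₀ ∧ Balanced H ∧ Balanced H₀ from
    h.imp fun H h => ⟨h.1, h.2.1⟩
  induction hreach with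
  | refl => exact ⟨_, .refl, rfl, balanced_initCfg, balanced_initCfg⟩
  | tail _ hstep ih =>
    obtain ⟨H, hsteps, hE, hH, hH₀⟩ := ih
    have hbal := hH₀.step hstep
    cases hstep with
    | slide v w c c' he hc =>
      exact ⟨H, hsteps, hE.trans (undirected_slideCfg c' he).symm, hH, hbal⟩
    | add v w c hpeb hc =>
      obtain ⟨H₁, hsteps₁, hH₁, hE₁, hle⟩ :=
        hH₀.exists_canonical_gather (ℓ := ℓ) {v, w} _ hH hE (Nat.le_add_left _ _)
      obtain ⟨H₂, hstep₂, hH₂, hE₂⟩ := hH₁.exists_canonical_addEdge v w (hpeb.trans hle)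
      exact ⟨H₂, (hsteps.trans hsteps₁).tail hstep₂,
        by rw [hE₂, hE₁]; simp [undirected, addEdgeCfg], hH₂, hbal⟩
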